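/- arXiv:1805.09530 — 2 statements merged into one kernel-verified Lean document; each statement's English description precedes it below -/
import Mathlib

section
/- Let (p^x) be a transition family for the G-lift with H_t^i < ∞ for all i ∈ S and t ≥ 0. Then the limits lim_{t→∞} (Σ_{i∈S} π̄ i·H_t^i)/t and lim_{t→∞} Σ_{i∈S} π̄ i·MI^i(X_1, X_t) both exist and are equal. -/
open Filter

noncomputable section

/-- Right-hand side of the master equation of the G-lift at state `x`. -/
def mEqDerivG {S : Type} [Fintype S] [DecidableEq S] {G : Type} [Group G]
    (q : S → S → ℝ) (σ : S → S → G)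
    (f : S × G → ℝ) (x : S × G) : ℝ :=
  ∑ j ∈ Finset.univ.erase x.1,
    (f (j, x.2 * σ x.1 j) * q j x.1 - f x * q x.1 j)

/-- `p` is a solution of the master equation of the G-lift. -/
def IsMasterSolutionG {S : Type} [Fintype S] [DecidableEq S] {G : Type} [Group G]
    (q : S → S → ℝ) (σ : S → S → G) (p : ℝ → S × G → ℝ) : Prop :=
  (∀ t : ℝ, 0 ≤ t → (∀ x, 0 ≤ p t x) ∧ (∑' x, p t x) = 1) ∧
  (∀ (x : S × G) (t : ℝ), 0 ≤ t →
    HasDerivWithinAt (fun s => p s x) (mEqDerivG q σ (p t) x) (Set.Ici 0) t)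

/-- A transition family for the G-lift. -/
def IsTransitionFamilyG {S : Type} [Fintype S] [DecidableEq S] {G : Type} [Group G]
    (q : S → S → ℝ) (σ : S → S → G) (P : S × G → ℝ → S × G → ℝ) : Prop :=
  (∀ x, IsMasterSolutionG q σ (P x)) ∧
  (∀ x, P x 0 x = 1 ∧ ∀ y, y ≠ x → P x 0 y = 0) ∧
  (∀ x z : S × G, ∀ s t : ℝ, 0 ≤ s → 0 ≤ t →
    P x (s + t) z = ∑' y, P x s y * P y t z)

/-- Entropy of a distribution on a countable set. -/
def Hent {X : Type*} (r : X → ℝ) : ℝ := ∑' x, Real.negMulLog (r x)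

/-- Mutual information of a joint distribution on a product of countable sets. -/
def MI {Y Z : Type*} (ρ : Y × Z → ℝ) : ℝ :=
  ∑' yz : Y × Z,
    ρ yz * Real.log (ρ yz / ((∑' z, ρ (yz.1, z)) * ∑' y, ρ (y, yz.2)))

/-- Tonelli for nonnegative real families, phrased with `HasSum`. -/
lemma hasSum_prod_of_nonneg_fiber {α β : Type*} {f : α × β → ℝ} {g : α → ℝ} {s : ℝ}
    (hf : ∀ x, 0 ≤ f x) (hfib : ∀ a, HasSum (fun b => f (a, b)) (g a)) (hg : HasSum g s) :
    HasSum f s := by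
  have hs : Summable f := (summable_prod_of_nonneg hf).2
    ⟨fun a => (hfib a).summable, by
      have : (fun a => ∑' b, f (a, b)) = g := funext fun a => (hfib a).tsum_eq
      rw [this]; exact hg.summable⟩
  have h := hs.hasSum.prod_fiberwise hfib
  rw [hg.unique h]
  exact hs.hasSum

lemma hasSum_triple_of_nonneg_fiber {α β γ : Type*} {f : α → β → γ → ℝ} {g : α → β → ℝ}
    {h : α → ℝ} {s : ℝ} (hf : ∀ a b c, 0 ≤ f a b c) (hfib : ∀ a b, HasSum (f a b) (g a b))
    (hg : ∀ a, HasSum (g a) (h a)) (hh : HasSum h s) :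
    HasSum (fun x : α × β × γ => f x.1 x.2.1 x.2.2) s :=
  hasSum_prod_of_nonneg_fiber (fun _ => hf _ _ _)
    (fun a => hasSum_prod_of_nonneg_fiber (fun _ => hf _ _ _) (fun b => hfib a b) (hg a)) hh

lemma hasSum_Hent {X : Type*} {r : X → ℝ} (h : Summable fun x => Real.negMulLog (r x)) :
    HasSum (fun x => r x * -Real.log (r x)) (Hent r) := by
  have : (fun x => r x * -Real.log (r x)) = fun x => Real.negMulLog (r x) := by
    funext x; rw [Real.negMulLog]; ring
  rw [this]
  exact h.hasSum

lemma HasSum.neg_log_nonneg {X : Type*} {r : X → ℝ} (h0 : ∀ x, 0 ≤ r x) (h1 : HasSum r 1)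
    (x : X) : 0 ≤ -Real.log (r x) :=
  neg_nonneg.2 (Real.log_nonpos (h0 x) (le_hasSum h1 x fun y _ => h0 y))

/-- For a Markov chain `Y → W → Z` the conditional mutual information of `Y` and `W` given `Z`
is nonnegative. -/
lemma entropy_markov_le {X : Type*} {p r v : X → ℝ} {K L N : X → X → ℝ} {hK hN : ℝ}
    (p0 : ∀ y, 0 ≤ p y) (K0 : ∀ y w, 0 ≤ K y w) (L0 : ∀ w z, 0 ≤ L w z)
    (p1 : HasSum p 1) (K1 : ∀ y, HasSum (K y) 1) (L1 : ∀ w, HasSum (L w) 1)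
    (r0 : ∀ w, 0 ≤ r w) (r1 : HasSum r 1) (v0 : ∀ z, 0 ≤ v z) (v1 : HasSum v 1)
    (N0 : ∀ y z, 0 ≤ N y z) (N1 : ∀ y, HasSum (N y) 1)
    (hr : ∀ w, HasSum (fun y => p y * K y w) (r w))
    (hNs : ∀ y z, HasSum (fun w => K y w * L w z) (N y z))
    (hv : ∀ z, HasSum (fun w => r w * L w z) (v z))
    (hv' : ∀ z, HasSum (fun y => p y * N y z) (v z))
    (sr : Summable fun x => Real.negMulLog (r x)) (sv : Summable fun x => Real.negMulLog (v x))
    (sK : ∀ y, Summable fun x => Real.negMulLog (K y x))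
    (sN : ∀ y, Summable fun x => Real.negMulLog (N y x))
    (HK : HasSum (fun y => p y * Hent (K y)) hK) (HN : HasSum (fun y => p y * Hent (N y)) hN) :
    hK + Hent v ≤ Hent r + hN := by
  have m0 : ∀ y w z, 0 ≤ p y * K y w * L w z := fun y w z =>
    mul_nonneg (mul_nonneg (p0 y) (K0 y w)) (L0 w z)
  -- coordinates are `(y, w, z)`
  let ewyz : X × X × X ≃ X × X × X :=
    ⟨fun x => (x.2.1, x.1, x.2.2), fun x => (x.2.1, x.1, x.2.2), fun _ => rfl, fun _ => rfl⟩
  let ezwy : X × X × X ≃ X × X × X :=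
    ⟨fun x => (x.2.2, x.2.1, x.1), fun x => (x.2.2, x.2.1, x.1), fun _ => rfl, fun _ => rfl⟩
  let eyzw : X × X × X ≃ X × X × X :=
    ⟨fun x => (x.1, x.2.2, x.2.1), fun x => (x.1, x.2.2, x.2.1), fun _ => rfl, fun _ => rfl⟩
  have A1 : HasSum (fun x : X × X × X =>
      p x.1 * K x.1 x.2.1 * L x.2.1 x.2.2 * -Real.log (K x.1 x.2.1)) hK := by
    refine hasSum_triple_of_nonneg_fiber
      (f := fun y w z => p y * K y w * L w z * -Real.log (K y w))
      (g := fun y w => p y * (K y w * -Real.log (K y w))) (h := fun y => p y * Hent (K y))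
      (fun y w z => mul_nonneg (m0 y w z) ((K1 y).neg_log_nonneg (K0 y) w))
      (fun y w => ?_) (fun y => (hasSum_Hent (sK y)).mul_left _) HK
    simpa only [mul_one, mul_assoc] using
      ((L1 w).mul_left (p y * K y w)).mul_right (-Real.log (K y w))
  have A2 : HasSum (fun x : X × X × X =>
      p x.1 * K x.1 x.2.1 * L x.2.1 x.2.2 * -Real.log (v x.2.2)) (Hent v) := by
    rw [← ezwy.hasSum_iff]
    refine hasSum_triple_of_nonneg_fiber
      (f := fun z w y => p y * K y w * L w z * -Real.log (v z))
      (g := fun z w => r w * L w z * -Real.log (v z)) (h := fun z => v z * -Real.log (v z))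
      (fun z w y => mul_nonneg (m0 y w z) (v1.neg_log_nonneg v0 z))
      (fun z w => ((hr w).mul_right _).mul_right _) (fun z => (hv z).mul_right _)
      (hasSum_Hent sv)
  have A3 : HasSum (fun x : X × X × X =>
      p x.1 * K x.1 x.2.1 * L x.2.1 x.2.2 * -Real.log (r x.2.1)) (Hent r) := by
    rw [← ewyz.hasSum_iff]
    refine hasSum_triple_of_nonneg_fiber
      (f := fun w y z => p y * K y w * L w z * -Real.log (r w))
      (g := fun w y => p y * K y w * -Real.log (r w)) (h := fun w => r w * -Real.log (r w))
      (fun w y z => mul_nonneg (m0 y w z) (r1.neg_log_nonneg r0 w))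
      (fun w y => ?_) (fun w => (hr w).mul_right _) (hasSum_Hent sr)
    simpa using ((L1 w).mul_left (p y * K y w)).mul_right (-Real.log (r w))
  have A4 : HasSum (fun x : X × X × X =>
      p x.1 * K x.1 x.2.1 * L x.2.1 x.2.2 * -Real.log (N x.1 x.2.2)) hN := by
    rw [← eyzw.hasSum_iff]
    refine hasSum_triple_of_nonneg_fiber
      (f := fun y z w => p y * K y w * L w z * -Real.log (N y z))
      (g := fun y z => p y * (N y z * -Real.log (N y z))) (h := fun y => p y * Hent (N y))
      (fun y z w => mul_nonneg (m0 y w z) ((N1 y).neg_log_nonneg (N0 y) z))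
      (fun y z => ?_) (fun y => (hasSum_Hent (sN y)).mul_left _) HN
    simpa only [mul_assoc] using ((hNs y z).mul_right (-Real.log (N y z))).mul_left (p y)
  have A5 : HasSum (fun x : X × X × X => p x.1 * K x.1 x.2.1 * L x.2.1 x.2.2) 1 := by
    refine hasSum_triple_of_nonneg_fiber (f := fun y w z => p y * K y w * L w z)
      (g := fun y w => p y * K y w) (h := p) m0 (fun y w => ?_) (fun y => ?_) p1
    · simpa using (L1 w).mul_left (p y * K y w)
    · simpa using (K1 y).mul_left (p y)
  have A6 : HasSum (fun x : X × X × X =>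
      r x.2.1 * L x.2.1 x.2.2 * (p x.1 * N x.1 x.2.2) / v x.2.2) 1 := by
    rw [← ezwy.hasSum_iff]
    refine hasSum_triple_of_nonneg_fiber
      (f := fun z w y => r w * L w z * (p y * N y z) / v z)
      (g := fun z w => r w * L w z * v z / v z) (h := fun z => v z)
      (fun z w y => div_nonneg (mul_nonneg (mul_nonneg (r0 w) (L0 w z))
        (mul_nonneg (p0 y) (N0 y z))) (v0 z))
      (fun z w => ((hv' z).mul_left _).div_const _) (fun z => ?_) v1
    simpa using ((hv z).mul_right (v z)).div_const (v z)
  have key := hasSum_le (f := fun x : X × X × X => _) (g := fun x : X × X × X => _) ?_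
    (((A1.add A2).sub (A3.add A4))) (A6.sub A5)
  · linarith
  rintro ⟨y, w, z⟩
  dsimp only
  rcases (m0 y w z).eq_or_lt with hm | hm
  · rw [← hm]
    have : 0 ≤ r w * L w z * (p y * N y z) / v z := div_nonneg (mul_nonneg
      (mul_nonneg (r0 w) (L0 w z)) (mul_nonneg (p0 y) (N0 y z))) (v0 z)
    simpa using this
  · have hL : 0 < L w z := (L0 w z).lt_of_ne' (right_ne_zero_of_mul hm.ne')
    have hpK : p y * K y w ≠ 0 := left_ne_zero_of_mul hm.ne'
    have hp : 0 < p y := (p0 y).lt_of_ne' (left_ne_zero_of_mul hpK)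
    have hk : 0 < K y w := (K0 y w).lt_of_ne' (right_ne_zero_of_mul hpK)
    have hrw : 0 < r w := (mul_pos hp hk).trans_le
      (le_hasSum (hr w) y fun y _ => mul_nonneg (p0 y) (K0 y w))
    have hNz : 0 < N y z := (mul_pos hk hL).trans_le
      (le_hasSum (hNs y z) w fun w _ => mul_nonneg (K0 y w) (L0 w z))
    have hvz : 0 < v z := (mul_pos hrw hL).trans_le
      (le_hasSum (hv z) w fun w _ => mul_nonneg (r0 w) (L0 w z))
    have hlog := Real.log_le_sub_one_of_pos (div_pos (mul_pos hrw hNz) (mul_pos hk hvz))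
    rw [Real.log_div (by positivity) (by positivity), Real.log_mul hrw.ne' hNz.ne',
      Real.log_mul hk.ne' hvz.ne'] at hlog
    have e : r w * L w z * (p y * N y z) / v z
        = p y * K y w * L w z * (r w * N y z / (K y w * v z)) := by
      field_simp
    rw [e]
    nlinarith [mul_le_mul_of_nonneg_left hlog hm.le]

lemma MI_eq_Hent_sub {X : Type*} {p r : X → ℝ} {K : X → X → ℝ} {hK : ℝ}
    (p0 : ∀ y, 0 ≤ p y) (K0 : ∀ y w, 0 ≤ K y w) (K1 : ∀ y, HasSum (K y) 1)
    (r0 : ∀ w, 0 ≤ r w) (r1 : HasSum r 1)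
    (hr : ∀ w, HasSum (fun y => p y * K y w) (r w))
    (sr : Summable fun x => Real.negMulLog (r x))
    (sK : ∀ y, Summable fun x => Real.negMulLog (K y x))
    (HK : HasSum (fun y => p y * Hent (K y)) hK) :
    MI (fun yz : X × X => p yz.1 * K yz.1 yz.2) = Hent r - hK := by
  have A1 : HasSum (fun x : X × X => p x.1 * (K x.1 x.2 * -Real.log (K x.1 x.2))) hK :=
    hasSum_prod_of_nonneg_fiber
      (fun x => mul_nonneg (p0 _) (mul_nonneg (K0 _ _) ((K1 _).neg_log_nonneg (K0 _) _)))
      (fun y => (hasSum_Hent (sK y)).mul_left _) HK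
  have A2 : HasSum (fun x : X × X => p x.1 * K x.1 x.2 * -Real.log (r x.2)) (Hent r) := by
    rw [← (Equiv.prodComm X X).hasSum_iff]
    exact hasSum_prod_of_nonneg_fiber
      (fun x => mul_nonneg (mul_nonneg (p0 _) (K0 _ _)) (r1.neg_log_nonneg r0 _))
      (fun w => (hr w).mul_right (-Real.log (r w))) (hasSum_Hent sr)
  rw [MI, ← (A2.sub A1).tsum_eq]
  refine tsum_congr fun x => ?_
  obtain ⟨y, w⟩ := x
  have e1 : ∑' z, p y * K y z = p y := by simpa using ((K1 y).mul_left (p y)).tsum_eq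
  simp only [e1, (hr w).tsum_eq]
  rcases eq_or_ne (p y * K y w) 0 with h | h
  · rw [h, ← mul_assoc, h]; simp
  · have hp : 0 < p y := (p0 y).lt_of_ne' (left_ne_zero_of_mul h)
    have hk : 0 < K y w := (K0 y w).lt_of_ne' (right_ne_zero_of_mul h)
    have hrw : 0 < r w := (mul_pos hp hk).trans_le
      (le_hasSum (hr w) y fun y _ => mul_nonneg (p0 y) (K0 y w))
    rw [mul_div_mul_left _ _ hp.ne', Real.log_div hk.ne' hrw.ne']
    ring

/-- A bounded family solving a linear differential equation with bounded coefficients and zero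
initial value vanishes. -/
lemma eq_zero_of_bounded_linear_ode {X : Type*} {u u' : ℝ → X → ℝ} {M C : ℝ}
    (h0 : ∀ x, u 0 x = 0) (hc : ∀ x, ContinuousOn (fun t => u t x) (Set.Ici 0))
    (hd : ∀ x t, 0 < t → HasDerivAt (fun t => u t x) (u' t x) t)
    (hM : ∀ t, 0 ≤ t → ∀ x, |u t x| ≤ M)
    (hu' : ∀ t, 0 < t → ∀ B, (∀ y, |u t y| ≤ B) → ∀ x, |u' t x| ≤ C * B)
    {t : ℝ} (ht : 0 ≤ t) (x : X) : u t x = 0 := by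
  have bound : ∀ n : ℕ, ∀ t, 0 ≤ t → ∀ x, |u t x| ≤ M * ((C * t) ^ n / n.factorial) := by
    intro n
    induction n with
    | zero => simpa using hM
    | succ n ih =>
      have hg : ∀ t : ℝ, HasDerivAt (fun t => M * ((C * t) ^ (n + 1) / (n + 1).factorial))
          (C * (M * ((C * t) ^ n / n.factorial))) t := by
        intro t
        have h1 : HasDerivAt (fun t : ℝ => C * t) C t := by
          simpa using (hasDerivAt_id t).const_mul C
        refine (((h1.pow (n + 1)).div_const ((n + 1).factorial : ℝ)).const_mul M).congr_deriv ?_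
        rw [Nat.factorial_succ]
        push_cast
        have : (n.factorial : ℝ) ≠ 0 := by positivity
        field_simp
      have mono : ∀ (f f' : ℝ → ℝ), f 0 = 0 → ContinuousOn f (Set.Ici 0) →
          (∀ t, 0 < t → HasDerivAt f (f' t) t) →
          (∀ t, 0 < t → f' t ≤ C * (M * ((C * t) ^ n / n.factorial))) →
          ∀ t, 0 ≤ t → f t ≤ M * ((C * t) ^ (n + 1) / (n + 1).factorial) := by
        intro f f' f0 fc fd fb t ht
        have hm : MonotoneOn
            (fun t => M * ((C * t) ^ (n + 1) / (n + 1).factorial) - f t) (Set.Ici 0) := by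
          refine monotoneOn_of_hasDerivWithinAt_nonneg (convex_Ici 0)
            (ContinuousOn.sub (fun t _ => (hg t).continuousAt.continuousWithinAt) fc)
            (f' := fun t => C * (M * ((C * t) ^ n / n.factorial)) - f' t) ?_ ?_
          · intro t ht
            rw [interior_Ici] at ht
            exact ((hg t).sub (fd t ht)).hasDerivWithinAt
          · intro t ht
            rw [interior_Ici] at ht
            exact sub_nonneg.2 (fb t ht)
        have := hm Set.self_mem_Ici ht ht
        simp only [f0, mul_zero] at this
        simp at this
        exact this
      intro t ht x
      rw [abs_le']
      constructor
      · exact mono (fun t => u t x) (fun t => u' t x) (h0 x) (hc x) (hd x)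
          (fun t ht => (le_abs_self _).trans (hu' t ht _ (ih t ht.le) x)) t ht
      · exact mono (fun t => -u t x) (fun t => -u' t x) (by simp [h0 x]) (hc x).neg
          (fun t ht => (hd x t ht).neg)
          (fun t ht => (neg_le_abs _).trans (hu' t ht _ (ih t ht.le) x)) t ht
  have lim : Tendsto (fun n : ℕ => M * ((C * t) ^ n / n.factorial)) atTop (nhds 0) := by
    simpa using (FloorSemiring.tendsto_pow_div_factorial_atTop (C * t)).const_mul M
  have := ge_of_tendsto' lim fun n => bound n t ht x
  exact abs_nonpos_iff.1 this

/-- A nonnegative function on `[0, ∞)` with nonincreasing increments grows linearly, with slope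
the limit of its unit increments. -/
lemma tendsto_div_and_increment {h : ℝ → ℝ} (h0 : ∀ t, 0 ≤ t → 0 ≤ h t)
    (hc : ∀ a t s, 0 ≤ a → 0 ≤ t → 0 ≤ s → h t + h (a + t + s) ≤ h (a + t) + h (t + s)) :
    ∃ C, Tendsto (fun t => h t / t) atTop (nhds C) ∧
      Tendsto (fun t => h t - h (t - 1)) atTop (nhds C) := by
  have hmono : ∀ a t, 0 ≤ a → 0 ≤ t → h t ≤ h (a + t) := by
    intro a t ha ht
    by_contra! hlt
    have hn : ∀ n : ℕ, h (t + n * a) ≤ h t + n * (h (a + t) - h t) := by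
      intro n
      induction n with
      | zero => simp
      | succ n ih =>
        have := hc a t (n * a) ha ht (by positivity)
        push_cast
        rw [show t + (n + 1) * a = a + t + n * a by ring]
        linarith
    obtain ⟨n, hn'⟩ := exists_nat_gt (h t / (h t - h (a + t)))
    rw [div_lt_iff₀ (by linarith)] at hn'
    have := hn n
    have := h0 (t + n * a) (by positivity)
    linarith
  have hanti : AntitoneOn (fun t => h t - h (t - 1)) (Set.Ici 1) := by
    intro s hs t ht hst
    rw [Set.mem_Ici] at hs ht
    have := hc 1 (s - 1) (t - s) zero_le_one (by linarith) (by linarith)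
    rw [show 1 + (s - 1) + (t - s) = t by ring, show 1 + (s - 1) = s by ring,
      show s - 1 + (t - s) = t - 1 by ring] at this
    dsimp only
    linarith
  have hlim : ∃ C, Tendsto (fun t => h t - h (t - 1)) atTop (nhds C) := by
    have ha : Antitone (fun t => h (max t 1) - h (max t 1 - 1)) := fun s t hst =>
      hanti (Set.mem_Ici.2 (le_max_right s 1)) (Set.mem_Ici.2 (le_max_right t 1))
        (max_le_max_right 1 hst)
    have hb : BddBelow (Set.range fun t => h (max t 1) - h (max t 1 - 1)) := by
      refine ⟨0, ?_⟩
      rintro _ ⟨t, rfl⟩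
      have := hmono 1 (max t 1 - 1) zero_le_one (sub_nonneg.2 (le_max_right _ _))
      rw [add_sub_cancel] at this
      exact sub_nonneg.2 this
    refine ⟨_, (tendsto_atTop_ciInf ha hb).congr' ?_⟩
    filter_upwards [eventually_ge_atTop 1] with t ht
    rw [max_eq_left ht]
  obtain ⟨C, hC⟩ := hlim
  refine ⟨C, ?_, hC⟩
  have hnat : Tendsto (fun n : ℕ => h n / n) atTop (nhds C) := by
    have h1 : Tendsto (fun n : ℕ => h ((n : ℝ) + 1) - h n) atTop (nhds C) := by
      have := hC.comp (tendsto_atTop_add_const_right atTop (1 : ℝ) tendsto_natCast_atTop_atTop)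
      refine this.congr fun n => ?_
      simp
    have h2 := h1.cesaro
    have h3 : Tendsto (fun n : ℕ => h 0 / (n : ℝ)) atTop (nhds 0) :=
      tendsto_const_nhds.div_atTop tendsto_natCast_atTop_atTop
    have h4 := h2.add h3
    rw [add_zero] at h4
    refine h4.congr fun n => ?_
    have := Finset.sum_range_sub (fun n : ℕ => h n) n
    push_cast at this
    rw [this]
    ring
  have hfl : Tendsto (fun t : ℝ => ⌊t⌋₊) atTop atTop := tendsto_nat_floor_atTop
  have r1 : Tendsto (fun t : ℝ => (⌊t⌋₊ : ℝ) / t) atTop (nhds 1) :=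
    tendsto_nat_floor_div_atTop
  have r2 : Tendsto (fun t : ℝ => ((⌊t⌋₊ + 1 : ℕ) : ℝ) / t) atTop (nhds 1) := by
    have := r1.add (tendsto_inv_atTop_zero (𝕜 := ℝ))
    rw [add_zero] at this
    refine this.congr fun t => ?_
    push_cast
    ring
  have lo := (hnat.comp hfl).mul r1
  have hi := (hnat.comp ((tendsto_add_atTop_nat 1).comp hfl)).mul r2
  rw [mul_one] at lo hi
  refine tendsto_of_tendsto_of_tendsto_of_le_of_le' lo hi ?_ ?_
  · filter_upwards [eventually_ge_atTop 1] with t ht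
    have hf : 1 ≤ ⌊t⌋₊ := Nat.one_le_floor_iff t |>.2 ht
    have hf' : (0 : ℝ) < ⌊t⌋₊ := by exact_mod_cast hf
    have := hmono (t - ⌊t⌋₊) ⌊t⌋₊ (sub_nonneg.2 (Nat.floor_le (by linarith))) hf'.le
    rw [sub_add_cancel] at this
    simp only [Function.comp]
    rw [div_mul_div_cancel₀ hf'.ne']
    gcongr
  · filter_upwards [eventually_ge_atTop 1] with t ht
    have := hmono ((⌊t⌋₊ + 1 : ℕ) - t) t
      (by push_cast; linarith [Nat.lt_floor_add_one t]) (by linarith)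
    rw [sub_add_cancel] at this
    simp only [Function.comp]
    rw [div_mul_div_cancel₀ (by positivity)]
    gcongr

/-- The sum of the absolute values of all rates. -/
def totalRate {S : Type} [Fintype S] (q : S → S → ℝ) : ℝ := ∑ i, ∑ j, |q i j|

lemma totalRate_nonneg {S : Type} [Fintype S] {q : S → S → ℝ} : 0 ≤ totalRate q :=
  Finset.sum_nonneg fun _ _ => Finset.sum_nonneg fun _ _ => abs_nonneg _

section Lift

variable {S : Type} [Fintype S] [DecidableEq S] {G : Type} [Group G]
  {q : S → S → ℝ} {σ : S → S → G}

lemma sum_erase_out_le (i : S) : ∑ j ∈ Finset.univ.erase i, |q i j| ≤ totalRate q :=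
  (Finset.sum_le_sum_of_subset_of_nonneg (Finset.subset_univ _) fun _ _ _ => abs_nonneg _).trans
    (Finset.single_le_sum (f := fun i => ∑ j, |q i j|)
      (fun _ _ => Finset.sum_nonneg fun _ _ => abs_nonneg _) (Finset.mem_univ i))

lemma sum_erase_in_le (i : S) : ∑ j ∈ Finset.univ.erase i, |q j i| ≤ totalRate q := by
  rw [totalRate, Finset.sum_comm]
  exact (Finset.sum_le_sum_of_subset_of_nonneg (Finset.subset_univ _)
    fun _ _ _ => abs_nonneg _).trans
    (Finset.single_le_sum (f := fun i => ∑ j, |q j i|)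
      (fun _ _ => Finset.sum_nonneg fun _ _ => abs_nonneg _) (Finset.mem_univ i))

lemma abs_sum_rates_le {f : S → ℝ} {b B : ℝ} {i : S} (hf : ∀ j, |f j| ≤ B) (hb : |b| ≤ B) :
    |∑ j ∈ Finset.univ.erase i, (f j * q j i - b * q i j)| ≤ (2 * totalRate q) * B := by
  have hB : 0 ≤ B := (abs_nonneg _).trans hb
  calc _ ≤ ∑ j ∈ Finset.univ.erase i, |f j * q j i - b * q i j| :=
        Finset.abs_sum_le_sum_abs _ _
    _ ≤ ∑ j ∈ Finset.univ.erase i, (B * |q j i| + B * |q i j|) := by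
        refine Finset.sum_le_sum fun j _ => (abs_sub _ _).trans ?_
        rw [abs_mul, abs_mul]
        gcongr
        exact hf j
    _ = B * (∑ j ∈ Finset.univ.erase i, |q j i| + ∑ j ∈ Finset.univ.erase i, |q i j|) := by
        rw [Finset.sum_add_distrib, ← Finset.mul_sum, ← Finset.mul_sum, mul_add]
    _ ≤ B * (totalRate q + totalRate q) := by
        gcongr
        · exact sum_erase_in_le i
        · exact sum_erase_out_le i
    _ = _ := by ring

namespace IsMasterSolutionG

variable {p p' : ℝ → S × G → ℝ}

lemma hasSum (h : IsMasterSolutionG q σ p) {t : ℝ} (ht : 0 ≤ t) : HasSum (p t) 1 := by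
  have h1 := (h.1 t ht).2
  have hs : Summable (p t) := by
    by_contra hn
    rw [tsum_eq_zero_of_not_summable hn] at h1
    exact zero_ne_one h1
  rw [← h1]
  exact hs.hasSum

lemma le_one (h : IsMasterSolutionG q σ p) {t : ℝ} (ht : 0 ≤ t) (x : S × G) : p t x ≤ 1 :=
  le_hasSum (h.hasSum ht) x fun y _ => (h.1 t ht).1 y

lemma continuousOn (h : IsMasterSolutionG q σ p) (x : S × G) :
    ContinuousOn (fun t => p t x) (Set.Ici 0) :=
  fun t ht => (h.2 x t ht).continuousWithinAt

lemma hasDerivAt (h : IsMasterSolutionG q σ p) (x : S × G) {t : ℝ} (ht : 0 < t) :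
    HasDerivAt (fun s => p s x) (mEqDerivG q σ (p t) x) t :=
  (h.2 x t ht.le).hasDerivAt (Ici_mem_nhds ht)

lemma unique (h : IsMasterSolutionG q σ p) (h' : IsMasterSolutionG q σ p')
    (h0 : p 0 = p' 0) {t : ℝ} (ht : 0 ≤ t) : p t = p' t := by
  funext x
  refine sub_eq_zero.1 (eq_zero_of_bounded_linear_ode (u := fun t x => p t x - p' t x)
    (u' := fun t x => mEqDerivG q σ (p t) x - mEqDerivG q σ (p' t) x) (M := 1)
    (C := 2 * totalRate q) (fun x => by simp [h0])
    (fun x => (h.continuousOn x).sub (h'.continuousOn x))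
    (fun x t ht => (h.hasDerivAt x ht).sub (h'.hasDerivAt x ht)) (fun t ht x => ?_)
    (fun t ht B hB x => ?_) ht x)
  · rw [abs_le]
    constructor <;> linarith [(h.1 t ht).1 x, (h'.1 t ht).1 x, h.le_one ht x, h'.le_one ht x]
  · rw [mEqDerivG, mEqDerivG, ← Finset.sum_sub_distrib]
    refine le_trans (le_of_eq ?_) (abs_sum_rates_le (i := x.1)
      (f := fun j => p t (j, x.2 * σ x.1 j) - p' t (j, x.2 * σ x.1 j))
      (fun j => hB _) (hB x))
    congr 1
    exact Finset.sum_congr rfl fun j _ => by ring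

lemma translate (h : IsMasterSolutionG q σ p) (g : G) :
    IsMasterSolutionG q σ (fun t x => p t (x.1, g * x.2)) := by
  refine ⟨fun t ht => ⟨fun x => (h.1 t ht).1 _, ?_⟩, fun x t ht => ?_⟩
  · rw [← (h.1 t ht).2]
    exact ((Equiv.refl S).prodCongr (Equiv.mulLeft g)).tsum_eq (p t)
  · have := h.2 (x.1, g * x.2) t ht
    simpa only [mEqDerivG, mul_assoc] using this

/-- Harnack-type bound: earlier values are controlled by later ones. -/
lemma le_exp_mul (h : IsMasterSolutionG q σ p) (hq : ∀ i j : S, i ≠ j → 0 ≤ q i j)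
    {t T : ℝ} (ht : 0 ≤ t) (htT : t ≤ T) (x : S × G) :
    p t x ≤ Real.exp (totalRate q * T) * p T x := by
  have hE : ∀ t : ℝ, HasDerivAt (fun t => Real.exp (totalRate q * t))
      (Real.exp (totalRate q * t) * totalRate q) t := fun t => by
    have h1 : HasDerivAt (fun t : ℝ => totalRate q * t) (totalRate q) t := by
      simpa using (hasDerivAt_id t).const_mul (totalRate q)
    exact h1.exp
  have hm : MonotoneOn (fun t => Real.exp (totalRate q * t) * p t x) (Set.Ici 0) := by
    refine monotoneOn_of_hasDerivWithinAt_nonneg (convex_Ici 0)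
      (ContinuousOn.mul (fun t _ => (hE t).continuousAt.continuousWithinAt) (h.continuousOn x))
      (f' := fun t => Real.exp (totalRate q * t) * totalRate q * p t x
        + Real.exp (totalRate q * t) * mEqDerivG q σ (p t) x) ?_ ?_
    · intro t ht
      rw [interior_Ici] at ht
      exact ((hE t).mul (h.hasDerivAt x ht)).hasDerivWithinAt
    · intro t ht
      rw [interior_Ici] at ht
      have h0 := (h.1 t (le_of_lt ht)).1
      have : -(totalRate q * p t x) ≤ mEqDerivG q σ (p t) x := by
        rw [mEqDerivG, Finset.sum_sub_distrib, ← Finset.mul_sum]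
        have h1 : 0 ≤ ∑ j ∈ Finset.univ.erase x.1, p t (j, x.2 * σ x.1 j) * q j x.1 :=
          Finset.sum_nonneg fun j hj => mul_nonneg (h0 _) (hq _ _ (Finset.ne_of_mem_erase hj))
        have h2 : ∑ j ∈ Finset.univ.erase x.1, q x.1 j ≤ totalRate q :=
          (Finset.sum_le_sum fun j _ => le_abs_self _).trans (sum_erase_out_le x.1)
        nlinarith [mul_le_mul_of_nonneg_left h2 (h0 x)]
      have he := Real.exp_pos (totalRate q * t)
      nlinarith
  have h1 := hm ht (ht.trans htT) htT
  refine le_trans ?_ h1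
  exact le_mul_of_one_le_left ((h.1 t ht).1 x)
    (Real.one_le_exp (mul_nonneg totalRate_nonneg ht))

lemma summable_fiber (h : IsMasterSolutionG q σ p) {t : ℝ} (ht : 0 ≤ t) (j : S) :
    Summable fun g => p t (j, g) :=
  (h.hasSum ht).summable.comp_injective (Prod.mk_right_injective j)

lemma hasSum_mul_fst (h : IsMasterSolutionG q σ p) {t : ℝ} (ht : 0 ≤ t) {E : S → ℝ}
    (hE : ∀ j, 0 ≤ E j) :
    HasSum (fun y => p t y * E y.1) (∑ j, (∑' g, p t (j, g)) * E j) :=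
  hasSum_prod_of_nonneg_fiber (fun y => mul_nonneg ((h.1 t ht).1 y) (hE _))
    (fun j => (h.summable_fiber ht j).hasSum.mul_right _) (hasSum_fintype _)

lemma continuousOn_fold (h : IsMasterSolutionG q σ p) (hq : ∀ i j : S, i ≠ j → 0 ≤ q i j)
    (j : S) : ContinuousOn (fun t => ∑' g, p t (j, g)) (Set.Ici 0) := by
  have hT : ∀ T : ℝ, 0 ≤ T → ContinuousOn (fun t => ∑' g, p t (j, g)) (Set.Icc 0 T) := by
    intro T hT
    refine continuousOn_tsum (u := fun g => Real.exp (totalRate q * T) * p T (j, g))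
      (fun g => (h.continuousOn (j, g)).mono Set.Icc_subset_Ici_self)
      ((h.summable_fiber hT j).mul_left _) (fun g t ht => ?_)
    rw [Real.norm_of_nonneg ((h.1 t ht.1).1 _)]
    exact h.le_exp_mul hq ht.1 ht.2 _
  intro t ht
  have ht' : (0 : ℝ) ≤ t := ht
  refine (hT (t + 1) (by linarith) t ⟨ht, by linarith⟩).mono_of_mem_nhdsWithin ?_
  rw [← Set.Ici_inter_Iic]
  exact Filter.inter_mem self_mem_nhdsWithin
    (mem_nhdsWithin_of_mem_nhds (Iic_mem_nhds (by linarith)))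

lemma hasDerivAt_fold (h : IsMasterSolutionG q σ p) (hq : ∀ i j : S, i ≠ j → 0 ≤ q i j)
    (j : S) {t : ℝ} (ht : 0 < t) :
    HasDerivAt (fun t => ∑' g, p t (j, g))
      (∑ k ∈ Finset.univ.erase j,
        ((∑' g, p t (k, g)) * q k j - (∑' g, p t (j, g)) * q j k)) t := by
  have hfib : ∀ t : ℝ, 0 ≤ t → ∀ k, HasSum (fun g => p t (k, g * σ j k)) (∑' g, p t (k, g)) :=
    fun t ht k => (Equiv.mulRight (σ j k)).hasSum_iff.2 (h.summable_fiber ht k).hasSum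
  have hsum : HasSum (fun g => mEqDerivG q σ (p t) (j, g))
      (∑ k ∈ Finset.univ.erase j,
        ((∑' g, p t (k, g)) * q k j - (∑' g, p t (j, g)) * q j k)) := by
    simp only [mEqDerivG]
    exact hasSum_sum fun k _ => ((hfib t ht.le k).mul_right _).sub
      ((h.summable_fiber ht.le j).hasSum.mul_right _)
  have hT : 0 ≤ t + 1 := by linarith
  have hmem : t ∈ Set.Ioo 0 (t + 1) := ⟨ht, by linarith⟩
  let u : G → ℝ := fun g => ∑ k ∈ Finset.univ.erase j,
      (Real.exp (totalRate q * (t + 1)) * p (t + 1) (k, g * σ j k) * |q k j|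
        + Real.exp (totalRate q * (t + 1)) * p (t + 1) (j, g) * |q j k|)
  have hu : Summable u :=
    summable_sum fun k _ => (((hfib _ hT k).summable.mul_left _).mul_right _).add
      (((h.summable_fiber hT j).mul_left _).mul_right _)
  have hbound : ∀ g, ∀ y ∈ Set.Ioo 0 (t + 1), ‖mEqDerivG q σ (p y) (j, g)‖ ≤ u g := by
    intro g y hy
    rw [mEqDerivG, Real.norm_eq_abs]
    refine (Finset.abs_sum_le_sum_abs _ _).trans (Finset.sum_le_sum fun k _ => ?_)
    refine (abs_sub _ _).trans ?_
    rw [abs_mul, abs_mul, abs_of_nonneg ((h.1 y hy.1.le).1 _),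
      abs_of_nonneg ((h.1 y hy.1.le).1 _)]
    gcongr
    · exact h.le_exp_mul hq hy.1.le hy.2.le _
    · exact h.le_exp_mul hq hy.1.le hy.2.le _
  exact (hasDerivAt_tsum_of_isPreconnected (g := fun g t => p t (j, g))
    (g' := fun g t => mEqDerivG q σ (p t) (j, g)) hu isOpen_Ioo isPreconnected_Ioo
    (fun g y hy => h.hasDerivAt (j, g) hy.1) hbound hmem
    (h.summable_fiber ht.le j) hmem).congr_deriv hsum.tsum_eq

lemma fold_nonneg (h : IsMasterSolutionG q σ p) {t : ℝ} (ht : 0 ≤ t) (j : S) :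
    0 ≤ ∑' g, p t (j, g) :=
  tsum_nonneg fun _ => (h.1 t ht).1 _

lemma fold_le_one (h : IsMasterSolutionG q σ p) {t : ℝ} (ht : 0 ≤ t) (j : S) :
    ∑' g, p t (j, g) ≤ 1 := by
  rw [← (h.1 t ht).2]
  exact tsum_comp_le_tsum_of_inj (h.hasSum ht).summable (h.1 t ht).1
    (Prod.mk_right_injective j)

end IsMasterSolutionG

namespace IsTransitionFamilyG

variable {P : S × G → ℝ → S × G → ℝ}

lemma apply_zero [DecidableEq G] (hP : IsTransitionFamilyG q σ P) (x : S × G) :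
    P x 0 = Pi.single x 1 := by
  funext y
  rcases eq_or_ne y x with rfl | h
  · simpa using (hP.2.1 y).1
  · rw [(hP.2.1 x).2 y h, Pi.single_eq_of_ne h]

lemma translate (hP : IsTransitionFamilyG q σ P) (i : S) (g : G) {t : ℝ} (ht : 0 ≤ t)
    (x : S × G) : P (i, g) t (x.1, g * x.2) = P (i, 1) t x := by
  classical
  refine congrFun (((hP.1 (i, g)).translate g).unique (hP.1 (i, 1)) ?_ ht) x
  funext y
  simp only [hP.apply_zero, Pi.single_apply, Prod.ext_iff, mul_eq_left]

lemma apply_eq_comp (hP : IsTransitionFamilyG q σ P) (i : S) (g : G) {t : ℝ} (ht : 0 ≤ t) :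
    P (i, g) t = P (i, 1) t ∘ ((Equiv.refl S).prodCongr (Equiv.mulLeft g⁻¹)) := by
  funext x
  have := hP.translate i g ht (x.1, g⁻¹ * x.2)
  simpa [Prod.map] using this

lemma Hent_eq (hP : IsTransitionFamilyG q σ P) (x : S × G) {t : ℝ} (ht : 0 ≤ t) :
    Hent (P x t) = Hent (P (x.1, 1) t) := by
  obtain ⟨i, g⟩ := x
  rw [hP.apply_eq_comp i g ht]
  exact ((Equiv.refl S).prodCongr (Equiv.mulLeft g⁻¹)).tsum_eq
    (fun x => Real.negMulLog (P (i, 1) t x))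

lemma summable_negMulLog (hP : IsTransitionFamilyG q σ P)
    (hH : ∀ i : S, ∀ t : ℝ, 0 ≤ t →
      Summable (fun z => Real.negMulLog (P (i, (1 : G)) t z)))
    (x : S × G) {t : ℝ} (ht : 0 ≤ t) : Summable fun z => Real.negMulLog (P x t z) := by
  obtain ⟨i, g⟩ := x
  rw [hP.apply_eq_comp i g ht]
  exact ((Equiv.refl S).prodCongr (Equiv.mulLeft g⁻¹)).summable_iff.2 (hH i t ht)

lemma Hent_nonneg (hP : IsTransitionFamilyG q σ P) (x : S × G) {t : ℝ} (ht : 0 ≤ t) :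
    0 ≤ Hent (P x t) :=
  tsum_nonneg fun y => Real.negMulLog_nonneg (((hP.1 x).1 t ht).1 y) ((hP.1 x).le_one ht y)

lemma hasSum_chapman (hP : IsTransitionFamilyG q σ P) (x z : S × G) {s t : ℝ} (hs : 0 ≤ s)
    (ht : 0 ≤ t) : HasSum (fun y => P x s y * P y t z) (P x (s + t) z) := by
  rw [hP.2.2 x z s t hs ht]
  refine (Summable.of_nonneg_of_le (fun y => mul_nonneg (((hP.1 x).1 s hs).1 y)
    (((hP.1 y).1 t ht).1 z)) (fun y => ?_) ((hP.1 x).hasSum hs).summable).hasSum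
  exact mul_le_of_le_one_right (((hP.1 x).1 s hs).1 y) ((hP.1 y).le_one ht z)

lemma hasSum_mul_Hent (hP : IsTransitionFamilyG q σ P) (x : S × G) {s t : ℝ} (hs : 0 ≤ s)
    (ht : 0 ≤ t) : HasSum (fun y => P x s y * Hent (P y t))
      (∑ j, (∑' g, P x s (j, g)) * Hent (P (j, 1) t)) := by
  have := (hP.1 x).hasSum_mul_fst hs (E := fun j => Hent (P (j, 1) t))
    fun j => hP.Hent_nonneg _ ht
  simpa only [← hP.Hent_eq _ ht] using this

/-- The folded chain preserves the stationary distribution. -/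
lemma sum_stationary_fold (hP : IsTransitionFamilyG q σ P)
    (hq : ∀ i j : S, i ≠ j → 0 ≤ q i j) {πb : S → ℝ} (hπ : ∀ i, 0 ≤ πb i)
    (hπsum : ∑ i, πb i = 1)
    (hπstat : ∀ j : S, ∑ i ∈ Finset.univ.erase j, (πb i * q i j - πb j * q j i) = 0)
    {t : ℝ} (ht : 0 ≤ t) (j : S) : ∑ i, πb i * ∑' g, P (i, 1) t (j, g) = πb j := by
  classical
  refine sub_eq_zero.1 (eq_zero_of_bounded_linear_ode
    (u := fun t j => ∑ i, πb i * ∑' g, P (i, 1) t (j, g) - πb j)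
    (u' := fun t j => ∑ i, πb i * ∑ k ∈ Finset.univ.erase j,
        ((∑' g, P (i, 1) t (k, g)) * q k j - (∑' g, P (i, 1) t (j, g)) * q j k)) (M := 1)
    (C := 2 * totalRate q) (fun j => ?_)
    (fun j => ?_) (fun j t ht => ?_) (fun t ht j => ?_) (fun t ht B hB j => ?_) ht j)
  · have : ∀ i, ∑' g, P (i, 1) 0 (j, g) = if i = j then 1 else 0 := by
      intro i
      rw [tsum_eq_single (1 : G)]
      · simp [hP.apply_zero, Pi.single_apply, eq_comm]
      · intro g hg
        simp [hP.apply_zero, hg]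
    simp [this]
  · exact (continuousOn_finsetSum _ fun i _ =>
      continuousOn_const.mul ((hP.1 (i, 1)).continuousOn_fold hq j)).sub continuousOn_const
  · exact (HasDerivAt.fun_sum fun i _ =>
      ((hP.1 (i, 1)).hasDerivAt_fold hq j ht).const_mul (πb i)).sub_const _
  · have h0 : 0 ≤ ∑ i, πb i * ∑' g, P (i, 1) t (j, g) :=
      Finset.sum_nonneg fun i _ => mul_nonneg (hπ i) ((hP.1 _).fold_nonneg ht j)
    have h1 : ∑ i, πb i * ∑' g, P (i, 1) t (j, g) ≤ 1 := by
      rw [← hπsum]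
      exact Finset.sum_le_sum fun i _ =>
        mul_le_of_le_one_right (hπ i) ((hP.1 _).fold_le_one ht j)
    have h2 : πb j ≤ 1 := hπsum ▸ Finset.single_le_sum (fun i _ => hπ i) (Finset.mem_univ j)
    rw [abs_le]
    constructor <;> linarith [hπ j]
  · refine le_trans (le_of_eq ?_) (abs_sum_rates_le (i := j)
      (f := fun k => ∑ i, πb i * ∑' g, P (i, 1) t (k, g) - πb k) hB (hB j))
    congr 1
    rw [← sub_zero (∑ i, _), ← hπstat j]
    simp_rw [Finset.mul_sum]
    rw [Finset.sum_comm, ← Finset.sum_sub_distrib]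
    refine Finset.sum_congr rfl fun k _ => ?_
    simp_rw [mul_sub, Finset.sum_sub_distrib, sub_mul, Finset.sum_mul, mul_assoc]
    ring

lemma sum_stationary_mul (hP : IsTransitionFamilyG q σ P)
    (hq : ∀ i j : S, i ≠ j → 0 ≤ q i j) {πb : S → ℝ} (hπ : ∀ i, 0 ≤ πb i)
    (hπsum : ∑ i, πb i = 1)
    (hπstat : ∀ j : S, ∑ i ∈ Finset.univ.erase j, (πb i * q i j - πb j * q j i) = 0)
    {t : ℝ} (ht : 0 ≤ t) (E : S → ℝ) :
    ∑ i, πb i * ∑ j, (∑' g, P (i, 1) t (j, g)) * E j = ∑ j, πb j * E j := by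
  simp_rw [Finset.mul_sum]
  rw [Finset.sum_comm]
  refine Finset.sum_congr rfl fun j _ => ?_
  rw [← hP.sum_stationary_fold hq hπ hπsum hπstat ht j, Finset.sum_mul]
  exact Finset.sum_congr rfl fun i _ => by ring

end IsTransitionFamilyG

end Lift

theorem stmt_10 {S : Type} [Fintype S] [DecidableEq S] (hS : 2 ≤ Fintype.card S)
    {G : Type} [Group G] [Countable G]
    (q : S → S → ℝ)
    (hq_nonneg : ∀ i j : S, i ≠ j → 0 ≤ q i j)
    (hq_sym : ∀ i j : S, i ≠ j → (0 < q i j ↔ 0 < q j i))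
    (hq_conn : ∀ i j : S, Relation.ReflTransGen (fun a b => a ≠ b ∧ 0 < q a b) i j)
    (πb : S → ℝ) (hπpos : ∀ i, 0 < πb i) (hπsum : ∑ i, πb i = 1)
    (hπstat : ∀ j : S,
      ∑ i ∈ Finset.univ.erase j, (πb i * q i j - πb j * q j i) = 0)
    (σ : S → S → G) (hσ : ∀ i j, σ j i = (σ i j)⁻¹)
    (P : S × G → ℝ → S × G → ℝ) (hP : IsTransitionFamilyG q σ P)
    -- H_t^i < ∞ for all i and t ≥ 0:
    (hH : ∀ i : S, ∀ t : ℝ, 0 ≤ t →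
      Summable (fun z => Real.negMulLog (P (i, (1 : G)) t z))) :
    -- the two limits exist and are equal:
    ∃ C : ℝ,
      Tendsto (fun t : ℝ => (∑ i : S, πb i * Hent (P (i, (1 : G)) t)) / t)
        atTop (nhds C) ∧
      Tendsto
        (fun t : ℝ => ∑ i : S, πb i *
          MI (fun yz : (S × G) × (S × G) => P (i, (1 : G)) 1 yz.1 * P yz.1 (t - 1) yz.2))
        atTop (nhds C) := by
  have hπ0 : ∀ i, 0 ≤ πb i := fun i => (hπpos i).le
  have hstat := fun {t : ℝ} (ht : 0 ≤ t) (E : S → ℝ) =>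
    hP.sum_stationary_mul hq_nonneg hπ0 hπsum hπstat ht E
  have P0 : ∀ x {t : ℝ}, 0 ≤ t → ∀ y, 0 ≤ P x t y := fun x t ht => ((hP.1 x).1 t ht).1
  have P1 : ∀ x {t : ℝ}, 0 ≤ t → HasSum (P x t) 1 := fun x t ht => (hP.1 x).hasSum ht
  obtain ⟨C, h1, h2⟩ := tendsto_div_and_increment
    (h := fun t => ∑ i : S, πb i * Hent (P (i, (1 : G)) t))
    (fun t ht => Finset.sum_nonneg fun i _ => mul_nonneg (hπ0 i) (hP.Hent_nonneg _ ht)) (by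
      intro a t s ha ht hs
      have key : ∀ i : S, _ := fun i => entropy_markov_le (p := P (i, 1) a)
        (K := fun y => P y t) (L := fun y => P y s) (N := fun y => P y (t + s))
        (r := P (i, 1) (a + t)) (v := P (i, 1) (a + t + s))
        (P0 _ ha) (fun y => P0 y ht) (fun y => P0 y hs) (P1 _ ha) (fun y => P1 y ht)
        (fun y => P1 y hs) (P0 _ (by positivity)) (P1 _ (by positivity))
        (P0 _ (by positivity)) (P1 _ (by positivity)) (fun y => P0 y (by positivity))
        (fun y => P1 y (by positivity))
        (fun w => hP.hasSum_chapman _ w ha ht) (fun y z => hP.hasSum_chapman y z ht hs)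
        (fun z => hP.hasSum_chapman _ z (by positivity) hs)
        (fun z => by
          rw [add_assoc]
          exact hP.hasSum_chapman _ z ha (by positivity))
        (hP.summable_negMulLog hH _ (by positivity))
        (hP.summable_negMulLog hH _ (by positivity))
        (fun y => hP.summable_negMulLog hH y ht)
        (fun y => hP.summable_negMulLog hH y (by positivity))
        (hP.hasSum_mul_Hent _ ha ht) (hP.hasSum_mul_Hent _ ha (by positivity))
      have := Finset.sum_le_sum fun i (_ : i ∈ Finset.univ) =>
        mul_le_mul_of_nonneg_left (key i) (hπ0 i)
      simp_rw [mul_add, Finset.sum_add_distrib] at this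
      rw [hstat ha, hstat ha] at this
      exact this)
  refine ⟨C, h1, h2.congr' ?_⟩
  filter_upwards [eventually_ge_atTop 1] with t ht
  have ht0 : 0 ≤ t := by linarith
  have ht1 : 0 ≤ t - 1 := by linarith
  have key : ∀ i : S, MI (fun yz : (S × G) × (S × G) =>
      P (i, (1 : G)) 1 yz.1 * P yz.1 (t - 1) yz.2) = Hent (P (i, 1) t)
        - ∑ j, (∑' g, P (i, 1) 1 (j, g)) * Hent (P (j, 1) (t - 1)) := fun i =>
    MI_eq_Hent_sub (K := fun y => P y (t - 1)) (P0 _ zero_le_one) (fun y => P0 y ht1)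
      (fun y => P1 y ht1) (P0 _ ht0) (P1 _ ht0)
      (fun w => by simpa using hP.hasSum_chapman (i, 1) w zero_le_one ht1)
      (hH i t ht0) (fun y => hP.summable_negMulLog hH y ht1)
      (hP.hasSum_mul_Hent _ zero_le_one ht1)
  simp_rw [key, mul_sub, Finset.sum_sub_distrib]
  rw [hstat zero_le_one]

end
end

section
/- Let (p^x) be a transition family for the G-lift with H_t^i < ∞ for all i ∈ S and t ≥ 0, and assume that for every i ∈ S the folded distribution of p^{(i,e)}(t) converges to π̄ in total variation as t → ∞ (which holds automatically for finite irreducible chains). If lim_{t→∞} (Σ_{i∈S} π̄ i·H_t^i)/t = C₁, then for every i ∈ S, lim_{t→∞} H_t^i/t exists and equals C₁. -/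
open Filter

noncomputable section

theorem abs_mEqDerivG_le {S : Type} [Fintype S] [DecidableEq S] {G : Type} [Group G]
    (q : S → S → ℝ) (σ : S → S → G) (f : S × G → ℝ) {M : ℝ} (hf : ∀ x, |f x| ≤ M)
    (x : S × G) :
    |mEqDerivG q σ f x| ≤ M * ∑ i, ∑ j, (|q j i| + |q i j|) := by
  have hM : 0 ≤ M := (abs_nonneg _).trans (hf x)
  calc |mEqDerivG q σ f x|
      ≤ ∑ j ∈ Finset.univ.erase x.1, M * (|q j x.1| + |q x.1 j|) := by
        refine (Finset.abs_sum_le_sum_abs _ _).trans (Finset.sum_le_sum fun j _ => ?_)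
        refine (abs_sub _ _).trans ?_
        rw [abs_mul, abs_mul, mul_add]
        gcongr <;> exact hf _
    _ ≤ ∑ j, M * (|q j x.1| + |q x.1 j|) :=
        Finset.sum_le_sum_of_subset_of_nonneg (Finset.subset_univ _)
          fun j _ _ => by positivity
    _ = M * ∑ j, (|q j x.1| + |q x.1 j|) := by rw [Finset.mul_sum]
    _ ≤ _ := by
        refine mul_le_mul_of_nonneg_left ?_ hM
        exact Finset.single_le_sum (f := fun i => ∑ j, (|q j i| + |q i j|))
          (fun i _ => by positivity) (Finset.mem_univ x.1)

theorem mEqDerivG_sub {S : Type} [Fintype S] [DecidableEq S] {G : Type} [Group G]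
    (q : S → S → ℝ) (σ : S → S → G) (f g : S × G → ℝ) (x : S × G) :
    mEqDerivG q σ (fun y => f y - g y) x = mEqDerivG q σ f x - mEqDerivG q σ g x := by
  unfold mEqDerivG
  rw [← Finset.sum_sub_distrib]
  exact Finset.sum_congr rfl fun j _ => by ring

/-- A bounded signed solution of the master equation that starts at zero vanishes. -/
theorem eq_zero_of_bounded_of_hasDerivWithinAt_mEqDerivG {S : Type} [Fintype S] [DecidableEq S]
    {G : Type} [Group G] (q : S → S → ℝ) (σ : S → S → G) {d : ℝ → S × G → ℝ} {C : ℝ}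
    (hd : ∀ (x : S × G) (t : ℝ), 0 ≤ t →
      HasDerivWithinAt (fun s => d s x) (mEqDerivG q σ (d t) x) (Set.Ici 0) t)
    (hC : ∀ t, 0 ≤ t → ∀ x, |d t x| ≤ C) (h0 : ∀ x, d 0 x = 0) {t : ℝ} (ht : 0 ≤ t)
    (x : S × G) : d t x = 0 := by
  set K : ℝ := ∑ i, ∑ j, (|q j i| + |q i j|)
  have key : ∀ n : ℕ, ∀ s, 0 ≤ s → ∀ x, |d s x| ≤ C * ((K * s) ^ n / n.factorial) := by
    intro n
    induction n with
    | zero => simpa using hC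
    | succ n ih =>
      intro s hs x
      have hB : ∀ u : ℝ, HasDerivAt
          (fun u => C * ((K * u) ^ (n + 1) / (n + 1).factorial))
          (C * ((K * u) ^ n / n.factorial) * K) u := by
        intro u
        have h1 := (((((hasDerivAt_id u).const_mul K).pow (n + 1)).div_const
          ((n + 1).factorial : ℝ)).const_mul C)
        refine h1.congr_deriv ?_
        have : (n.factorial : ℝ) ≠ 0 := by positivity
        rw [Nat.factorial_succ]
        push_cast
        have : (n : ℝ) + 1 ≠ 0 := by positivity
        simp only [id]
        field_simp
      refine image_norm_le_of_norm_deriv_right_le_deriv_boundary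
        (f := fun u => d u x) (f' := fun u => mEqDerivG q σ (d u) x) (a := 0) (b := s)
        ?_ ?_ ?_ hB ?_ ⟨hs, le_rfl⟩
      · exact fun u hu => ((hd x u hu.1).continuousWithinAt).mono Set.Icc_subset_Ici_self
      · exact fun u hu => (hd x u hu.1).mono (Set.Ici_subset_Ici.2 hu.1)
      · simp [h0]
      · exact fun u hu => abs_mEqDerivG_le q σ (d u) (ih u hu.1) x
  have hlim : Tendsto (fun n : ℕ => C * ((K * t) ^ n / n.factorial)) atTop (nhds 0) := by
    simpa using (FloorSemiring.tendsto_pow_div_factorial_atTop (K * t)).const_mul C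
  exact abs_nonpos_iff.1 (ge_of_tendsto' hlim fun n => key n t ht x)

theorem summable_of_tsum_eq_one {X : Type*} {f : X → ℝ} (h : ∑' x, f x = 1) : Summable f := by
  by_contra hn
  simp [tsum_eq_zero_of_not_summable hn] at h

theorem IsMasterSolutionG.summable {S : Type} [Fintype S] [DecidableEq S] {G : Type} [Group G]
    {q : S → S → ℝ} {σ : S → S → G} {p : ℝ → S × G → ℝ} (hp : IsMasterSolutionG q σ p)
    {t : ℝ} (ht : 0 ≤ t) : Summable (p t) :=
  summable_of_tsum_eq_one (hp.1 t ht).2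

theorem IsMasterSolutionG.le_one_s11 {S : Type} [Fintype S] [DecidableEq S] {G : Type} [Group G]
    {q : S → S → ℝ} {σ : S → S → G} {p : ℝ → S × G → ℝ} (hp : IsMasterSolutionG q σ p)
    {t : ℝ} (ht : 0 ≤ t) (x : S × G) : p t x ≤ 1 :=
  (hp.1 t ht).2 ▸ (hp.summable ht).le_tsum x fun y _ => (hp.1 t ht).1 y

/-- Solutions of the master equation are determined by their initial distribution. -/
theorem IsMasterSolutionG.unique_s11 {S : Type} [Fintype S] [DecidableEq S] {G : Type} [Group G]
    {q : S → S → ℝ} {σ : S → S → G} {p p' : ℝ → S × G → ℝ}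
    (hp : IsMasterSolutionG q σ p) (hp' : IsMasterSolutionG q σ p') (h0 : p 0 = p' 0)
    {t : ℝ} (ht : 0 ≤ t) : p t = p' t := by
  funext x
  refine sub_eq_zero.1 (eq_zero_of_bounded_of_hasDerivWithinAt_mEqDerivG q σ
    (d := fun s y => p s y - p' s y) (C := 1) ?_ ?_ ?_ ht x)
  · intro y s hs
    rw [mEqDerivG_sub]
    exact (hp.2 y s hs).sub (hp'.2 y s hs)
  · intro s hs y
    rw [abs_le]
    constructor <;>
      linarith [(hp.1 s hs).1 y, (hp'.1 s hs).1 y, hp.le_one_s11 hs y, hp'.le_one_s11 hs y]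
  · simp [h0]

/-- Left translation in the group coordinate. -/
def leftTranslate (S : Type) {G : Type} [Group G] (g : G) : S × G ≃ S × G :=
  (Equiv.refl S).prodCongr (Equiv.mulLeft g)

theorem IsMasterSolutionG.leftTranslate {S : Type} [Fintype S] [DecidableEq S] {G : Type}
    [Group G] {q : S → S → ℝ} {σ : S → S → G} {p : ℝ → S × G → ℝ}
    (hp : IsMasterSolutionG q σ p) (g : G) :
    IsMasterSolutionG q σ (fun t x => p t (leftTranslate S g x)) := by
  refine ⟨fun t ht => ⟨fun x => (hp.1 t ht).1 _, ?_⟩, fun x t ht => ?_⟩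
  · exact ((_root_.leftTranslate S g).tsum_eq (p t)).trans (hp.1 t ht).2
  · refine (hp.2 (_root_.leftTranslate S g x) t ht).congr_deriv ?_
    simp [mEqDerivG, _root_.leftTranslate, mul_assoc]

/-- The law started at `(j, g)` is the left translate by `g` of the law started at `(j, 1)`. -/
theorem IsTransitionFamilyG.apply_leftTranslate {S : Type} [Fintype S] [DecidableEq S] {G : Type}
    [Group G] {q : S → S → ℝ} {σ : S → S → G} {P : S × G → ℝ → S × G → ℝ}
    (hP : IsTransitionFamilyG q σ P) (j : S) (g : G) {t : ℝ} (ht : 0 ≤ t) (x : S × G) :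
    P (j, g) t (leftTranslate S g x) = P (j, 1) t x := by
  refine congrFun (((hP.1 (j, g)).leftTranslate g).unique_s11 (hP.1 (j, 1)) ?_ ht) x
  funext y
  have hg : leftTranslate S g (j, 1) = (j, g) := by simp [leftTranslate]
  by_cases hy : y = (j, 1)
  · rw [hy, hg, (hP.2.1 _).1, (hP.2.1 _).1]
  · rw [(hP.2.1 (j, 1)).2 y hy, (hP.2.1 (j, g)).2]
    rw [← hg]
    exact fun h => hy ((leftTranslate S g).injective h)

theorem negMulLog_tsum_le {X : Type*} {a : X → ℝ} (ha : ∀ y, 0 ≤ a y) (hs : Summable a)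
    (hη : Summable fun y => Real.negMulLog (a y)) :
    Real.negMulLog (∑' y, a y) ≤ ∑' y, Real.negMulLog (a y) := by
  have h : Real.negMulLog (∑' y, a y) = ∑' y, a y * -Real.log (∑' y, a y) := by
    rw [tsum_mul_right, Real.negMulLog]
    ring
  rw [h]
  refine (hs.mul_right _).tsum_le_tsum (fun y => ?_) hη
  rcases (ha y).eq_or_lt with h0 | h0
  · simp [← h0]
  · have := Real.log_le_log h0 (hs.le_tsum y fun z _ => ha z)
    rw [Real.negMulLog]
    nlinarith

theorem negMulLog_le_tangent {x c : ℝ} (hx : 0 ≤ x) (hc : 0 < c) :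
    Real.negMulLog x ≤ x * -Real.log c + (c - x) := by
  rcases hx.eq_or_lt with h0 | h0
  · simp [← h0, hc.le]
  · have h1 := Real.log_le_sub_one_of_pos (div_pos hc h0)
    rw [Real.log_div hc.ne' h0.ne'] at h1
    have h2 := mul_le_mul_of_nonneg_left h1 hx
    have h3 : x * (c / x - 1) = c - x := by field_simp
    rw [Real.negMulLog]
    linarith

theorem tsum_mul_negMulLog_le {X : Type*} {p x : X → ℝ} (hp : ∀ y, 0 ≤ p y)
    (hp1 : ∑' y, p y = 1) (hx : ∀ y, 0 ≤ x y) (hs : Summable fun y => p y * x y)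
    (hη : Summable fun y => p y * Real.negMulLog (x y)) :
    ∑' y, p y * Real.negMulLog (x y) ≤ Real.negMulLog (∑' y, p y * x y) := by
  have hps : Summable p := summable_of_tsum_eq_one hp1
  have hpx : ∀ y, 0 ≤ p y * x y := fun y => mul_nonneg (hp y) (hx y)
  rcases (tsum_nonneg hpx).eq_or_lt with h0 | h0
  · have hz : (fun y => p y * x y) = 0 :=
      (hasSum_zero_iff_of_nonneg hpx).1 (h0 ▸ hs.hasSum)
    have : ∀ y, p y * Real.negMulLog (x y) = 0 := fun y => by
      have : p y * x y = 0 := congrFun hz y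
      rcases mul_eq_zero.1 this with h | h <;> simp [h]
    simp [this, ← h0]
  · set c := ∑' y, p y * x y
    have h : HasSum (fun y => p y * x y * -Real.log c + (p y * c - p y * x y))
        (c * -Real.log c + (1 * c - c)) :=
      (hs.hasSum.mul_right _).add (((hp1 ▸ hps.hasSum).mul_right c).sub hs.hasSum)
    calc _ ≤ c * -Real.log c + (1 * c - c) := by
          refine hasSum_le (fun y => ?_) hη.hasSum h
          have := mul_le_mul_of_nonneg_left (negMulLog_le_tangent (hx y) h0) (hp y)
          linarith
      _ = _ := by rw [Real.negMulLog]; ring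

/-- Data of a mixture `z ↦ ∑' y, p y * r y z` of the distributions `r y`, of uniformly bounded
entropy, with weights `p`. -/
structure IsEntropyMixture {X : Type*} (p : X → ℝ) (r : X → X → ℝ) (B : ℝ) : Prop where
  weight_nonneg : ∀ y, 0 ≤ p y
  tsum_weight : ∑' y, p y = 1
  nonneg : ∀ y z, 0 ≤ r y z
  tsum_eq_one : ∀ y, ∑' z, r y z = 1
  summable_entropy : ∀ y, Summable fun z => Real.negMulLog (r y z)
  entropy_le : ∀ y, Hent (r y) ≤ B

namespace IsEntropyMixture

variable {X : Type*} {p : X → ℝ} {r : X → X → ℝ} {B : ℝ}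

theorem weight_le_one (h : IsEntropyMixture p r B) (y : X) : p y ≤ 1 :=
  h.tsum_weight ▸ (summable_of_tsum_eq_one h.tsum_weight).le_tsum y fun z _ => h.weight_nonneg z

theorem le_one_s11 (h : IsEntropyMixture p r B) (y z : X) : r y z ≤ 1 :=
  h.tsum_eq_one y ▸
    (summable_of_tsum_eq_one (h.tsum_eq_one y)).le_tsum z fun z _ => h.nonneg y z

theorem negMulLog_nonneg (h : IsEntropyMixture p r B) (y z : X) :
    0 ≤ Real.negMulLog (r y z) :=
  Real.negMulLog_nonneg (h.nonneg y z) (h.le_one_s11 y z)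

theorem entropy_nonneg (h : IsEntropyMixture p r B) (y : X) : 0 ≤ Hent (r y) :=
  tsum_nonneg (h.negMulLog_nonneg y)

theorem summable_weight_mul_entropy (h : IsEntropyMixture p r B) :
    Summable fun y => p y * Hent (r y) :=
  Summable.of_nonneg_of_le (fun y => mul_nonneg (h.weight_nonneg y) (h.entropy_nonneg y))
    (fun y => mul_le_mul_of_nonneg_left (h.entropy_le y) (h.weight_nonneg y))
    ((summable_of_tsum_eq_one h.tsum_weight).mul_right B)

theorem summable_mul (h : IsEntropyMixture p r B) (z : X) : Summable fun y => p y * r y z :=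
  Summable.of_nonneg_of_le (fun y => mul_nonneg (h.weight_nonneg y) (h.nonneg y z))
    (fun y => mul_le_of_le_one_right (h.weight_nonneg y) (h.le_one_s11 y z))
    (summable_of_tsum_eq_one h.tsum_weight)

theorem summable_mul_negMulLog (h : IsEntropyMixture p r B) :
    Summable fun yz : X × X => p yz.1 * Real.negMulLog (r yz.1 yz.2) := by
  refine (summable_prod_of_nonneg
    fun yz => mul_nonneg (h.weight_nonneg _) (h.negMulLog_nonneg _ _)).2
    ⟨fun y => (h.summable_entropy y).mul_left (p y), ?_⟩
  simpa only [tsum_mul_left, Hent] using h.summable_weight_mul_entropy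

theorem tsum_tsum_mul_negMulLog (h : IsEntropyMixture p r B) :
    ∑' z, ∑' y, p y * Real.negMulLog (r y z) = ∑' y, p y * Hent (r y) := by
  rw [Summable.tsum_comm (f := fun y z => p y * Real.negMulLog (r y z)) h.summable_mul_negMulLog]
  simp only [tsum_mul_left, Hent]

theorem tsum_weight_mul_entropy_le (h : IsEntropyMixture p r B)
    (hm : Summable fun z => Real.negMulLog (∑' y, p y * r y z)) :
    ∑' y, p y * Hent (r y) ≤ Hent fun z => ∑' y, p y * r y z := by
  have hsymm : Summable fun zy : X × X => p zy.2 * Real.negMulLog (r zy.2 zy.1) :=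
    h.summable_mul_negMulLog.prod_symm
  have hprod : Summable fun z => ∑' y, p y * Real.negMulLog (r y z) := hsymm.prod
  rw [← h.tsum_tsum_mul_negMulLog]
  exact hprod.tsum_le_tsum
    (fun z => tsum_mul_negMulLog_le h.weight_nonneg h.tsum_weight (fun y => h.nonneg y z)
      (h.summable_mul z) (hsymm.prod_factor z)) hm

theorem entropy_mixture_le (h : IsEntropyMixture p r B)
    (hp : Summable fun y => Real.negMulLog (p y))
    (hm : Summable fun z => Real.negMulLog (∑' y, p y * r y z)) :
    (Hent fun z => ∑' y, p y * r y z) ≤ Hent p + ∑' y, p y * Hent (r y) := by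
  have hr : Summable fun yz : X × X => r yz.1 yz.2 * Real.negMulLog (p yz.1) := by
    refine (summable_prod_of_nonneg fun yz => mul_nonneg (h.nonneg _ _)
      (Real.negMulLog_nonneg (h.weight_nonneg _) (h.weight_le_one _))).2
      ⟨fun y => (summable_of_tsum_eq_one (h.tsum_eq_one y)).mul_right (Real.negMulLog (p y)), ?_⟩
    simpa only [tsum_mul_right, h.tsum_eq_one, one_mul] using hp
  have hsum : Summable fun yz : X × X => Real.negMulLog (p yz.1 * r yz.1 yz.2) := by
    simpa only [Real.negMulLog_mul] using hr.add h.summable_mul_negMulLog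
  have hsymm : Summable fun zy : X × X => Real.negMulLog (p zy.2 * r zy.2 zy.1) :=
    hsum.prod_symm
  have hprod : Summable fun z => ∑' y, Real.negMulLog (p y * r y z) := hsymm.prod
  calc (Hent fun z => ∑' y, p y * r y z)
      ≤ ∑' z, ∑' y, Real.negMulLog (p y * r y z) :=
        hm.tsum_le_tsum (fun z => negMulLog_tsum_le
          (fun y => mul_nonneg (h.weight_nonneg y) (h.nonneg y z)) (h.summable_mul z)
          (hsymm.prod_factor z)) hprod
    _ = ∑' y, (Real.negMulLog (p y) + p y * Hent (r y)) := by
        rw [Summable.tsum_comm (f := fun y z => Real.negMulLog (p y * r y z)) hsum]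
        refine tsum_congr fun y => ?_
        simp only [Real.negMulLog_mul]
        rw [Summable.tsum_add (hr.prod_factor y) (h.summable_mul_negMulLog.prod_factor y)]
        simp only [tsum_mul_right, tsum_mul_left, h.tsum_eq_one, one_mul, Hent]
    _ = _ := hp.tsum_add h.summable_weight_mul_entropy

end IsEntropyMixture

/-- Entropy at time `s + t` in terms of the entropies at time `t`, weighted by the folded
distribution at time `s`. -/
theorem IsTransitionFamilyG.entropy_add_bounds {S : Type} [Fintype S] [DecidableEq S] {G : Type}
    [Group G] {q : S → S → ℝ} {σ : S → S → G} {P : S × G → ℝ → S × G → ℝ}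
    (hP : IsTransitionFamilyG q σ P)
    (hH : ∀ i : S, ∀ t : ℝ, 0 ≤ t →
      Summable (fun z => Real.negMulLog (P (i, (1 : G)) t z)))
    (i : S) {s t : ℝ} (hs : 0 ≤ s) (ht : 0 ≤ t) :
    ∑ j, (∑' g : G, P (i, 1) s (j, g)) * Hent (P (j, 1) t) ≤ Hent (P (i, 1) (s + t)) ∧
      Hent (P (i, 1) (s + t)) ≤
        Hent (P (i, 1) s) + ∑ j, (∑' g : G, P (i, 1) s (j, g)) * Hent (P (j, 1) t) := by
  have hent : ∀ y : S × G, Hent (P y t) = Hent (P (y.1, 1) t) := fun y => by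
    rw [Hent, ← (leftTranslate S y.2).tsum_eq]
    exact tsum_congr fun z => congrArg _ (hP.apply_leftTranslate y.1 y.2 ht z)
  have hnonneg : ∀ j : S, 0 ≤ Hent (P (j, 1) t) := fun j => tsum_nonneg fun z =>
    Real.negMulLog_nonneg (((hP.1 _).1 t ht).1 z) ((hP.1 _).le_one_s11 ht z)
  have hmix : IsEntropyMixture (P (i, 1) s) (fun y => P y t) (∑ j, Hent (P (j, 1) t)) := by
    refine ⟨((hP.1 _).1 s hs).1, ((hP.1 _).1 s hs).2, fun y => ((hP.1 y).1 t ht).1,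
      fun y => ((hP.1 y).1 t ht).2, fun y => ?_, fun y => ?_⟩
    · rw [← (leftTranslate S y.2).summable_iff]
      refine (hH y.1 t ht).congr fun z => ?_
      exact congrArg _ (hP.apply_leftTranslate y.1 y.2 ht z).symm
    · rw [hent]
      exact Finset.single_le_sum (f := fun j => Hent (P (j, 1) t)) (fun j _ => hnonneg j)
        (Finset.mem_univ y.1)
  have hmixture : (fun z => ∑' y, P (i, 1) s y * P y t z) = P (i, 1) (s + t) :=
    funext fun z => (hP.2.2 (i, 1) z s t hs ht).symm
  have hm : Summable fun z => Real.negMulLog (∑' y, P (i, 1) s y * P y t z) := by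
    simpa only [← hP.2.2 (i, 1) _ s t hs ht] using hH i (s + t) (add_nonneg hs ht)
  have hfold : ∑' y, P (i, 1) s y * Hent (P y t) =
      ∑ j, (∑' g : G, P (i, 1) s (j, g)) * Hent (P (j, 1) t) := by
    rw [hmix.summable_weight_mul_entropy.tsum_prod, tsum_fintype]
    refine Finset.sum_congr rfl fun j _ => ?_
    rw [← tsum_mul_right]
    exact tsum_congr fun g => by rw [hent]
  rw [← hfold, ← hmixture]
  exact ⟨hmix.tsum_weight_mul_entropy_le hm, hmix.entropy_mixture_le (hH i s hs) hm⟩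

/-- If `b (s + t)` lies within `b s` of averages of the `a j t` whose weights tend to `w` as
`s → ∞`, then `b` grows linearly at the same rate as the `w`-average of the `a j`. -/
theorem tendsto_div_of_average_bounds {S : Type*} [Fintype S] {w : S → ℝ} (hw : ∀ j, 0 < w j)
    {a : S → ℝ → ℝ} {b : ℝ → ℝ} {f : ℝ → S → ℝ} {C : ℝ}
    (ha : ∀ j t, 0 ≤ t → 0 ≤ a j t)
    (hf : Tendsto (fun s => ∑ j, |f s j - w j|) atTop (nhds 0))
    (hlower : ∀ s t, 0 ≤ s → 0 ≤ t → ∑ j, f s j * a j t ≤ b (s + t))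
    (hupper : ∀ s t, 0 ≤ s → 0 ≤ t → b (s + t) ≤ b s + ∑ j, f s j * a j t)
    (hC : Tendsto (fun t => (∑ j, w j * a j t) / t) atTop (nhds C)) :
    Tendsto (fun t => b t / t) atTop (nhds C) := by
  obtain ⟨D, hD, hB⟩ : ∃ D, 0 < D ∧ ∀ᶠ t in atTop, ∀ j, a j t ≤ D * t := by
    have hD : ∀ j, 0 < (|C| + 1) / w j := fun j => div_pos (by positivity) (hw j)
    refine ⟨1 + ∑ j, (|C| + 1) / w j,
      add_pos_of_pos_of_nonneg one_pos (Finset.sum_nonneg fun j _ => (hD j).le), ?_⟩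
    have hlt : C < |C| + 1 := (le_abs_self C).trans_lt (lt_add_one _)
    filter_upwards [hC.eventually_lt_const hlt, eventually_gt_atTop 0] with t h1 ht j
    rw [div_lt_iff₀ ht] at h1
    have h2 : w j * a j t ≤ ∑ j, w j * a j t :=
      Finset.single_le_sum (f := fun j => w j * a j t)
        (fun k _ => mul_nonneg (hw k).le (ha k t ht.le)) (Finset.mem_univ j)
    have h3 : (|C| + 1) / w j ≤ ∑ j, (|C| + 1) / w j :=
      Finset.single_le_sum (f := fun j => (|C| + 1) / w j) (fun k _ => (hD k).le)
        (Finset.mem_univ j)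
    calc a j t ≤ (|C| + 1) / w j * t := by
          rw [div_mul_eq_mul_div, le_div_iff₀ (hw j)]
          linarith
      _ ≤ _ := by gcongr; linarith
  rw [Metric.tendsto_atTop']
  intro ε hε
  obtain ⟨s, hsδ, hs⟩ := ((hf.eventually_lt_const
    (show 0 < ε / 3 / D by positivity)).and (eventually_ge_atTop 0)).exists
  have hshift : Tendsto (fun u : ℝ => u - s) atTop atTop :=
    tendsto_atTop_add_const_right _ (-s) tendsto_id
  have hratio : Tendsto (fun u : ℝ => (u - s) / u) atTop (nhds 1) := by
    have : Tendsto (fun u : ℝ => 1 - s / u) atTop (nhds (1 - 0)) :=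
      tendsto_const_nhds.sub (tendsto_id.const_div_atTop s)
    rw [sub_zero] at this
    refine this.congr' ?_
    filter_upwards [eventually_gt_atTop 0] with u hu
    field_simp
  have hA : Tendsto (fun u => (∑ j, w j * a j (u - s)) / u) atTop (nhds C) := by
    have := (hC.comp hshift).mul hratio
    rw [mul_one] at this
    refine this.congr' ?_
    filter_upwards [eventually_gt_atTop s] with u hu
    have hu' : u - s ≠ 0 := (sub_pos.2 hu).ne'
    simp only [Function.comp_apply]
    field_simp
  have hb : Tendsto (fun u : ℝ => b s / u) atTop (nhds 0) := tendsto_id.const_div_atTop (b s)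
  have hev : ∀ᶠ u in atTop, dist (b u / u) C < ε := by
    filter_upwards [hA.eventually (Metric.ball_mem_nhds C (show 0 < ε / 3 by positivity)),
      hb.eventually (Metric.ball_mem_nhds 0 (show 0 < ε / 3 by positivity)),
      hshift.eventually hB, eventually_gt_atTop s] with u h1 h2 h3 hu
    have ht : 0 < u - s := sub_pos.2 hu
    have hu0 : 0 < u := hs.trans_lt hu
    rw [Real.dist_eq] at h1 h2
    rw [sub_zero] at h2
    have hdiff : |∑ j, f s j * a j (u - s) - ∑ j, w j * a j (u - s)| ≤ ε / 3 * u := by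
      rw [← Finset.sum_sub_distrib]
      calc _ ≤ ∑ j, |f s j - w j| * (D * (u - s)) := by
            refine (Finset.abs_sum_le_sum_abs _ _).trans (Finset.sum_le_sum fun j _ => ?_)
            rw [← sub_mul, abs_mul, abs_of_nonneg (ha j _ ht.le)]
            gcongr
            exact h3 j
        _ = (∑ j, |f s j - w j|) * (D * (u - s)) := by rw [Finset.sum_mul]
        _ ≤ ε / 3 / D * (D * (u - s)) := by gcongr
        _ = ε / 3 * (u - s) := by field_simp
        _ ≤ _ := by gcongr; linarith
    have hlo := hlower s (u - s) hs ht.le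
    have hup := hupper s (u - s) hs ht.le
    rw [add_sub_cancel] at hlo hup
    rw [abs_le] at hdiff
    rw [abs_lt] at h1 h2
    rw [lt_sub_iff_add_lt, sub_lt_iff_lt_add, lt_div_iff₀ hu0, div_lt_iff₀ hu0] at h1
    rw [lt_div_iff₀ hu0, div_lt_iff₀ hu0] at h2
    rw [Real.dist_eq, abs_lt, lt_sub_iff_add_lt, sub_lt_iff_lt_add, lt_div_iff₀ hu0,
      div_lt_iff₀ hu0]
    constructor <;> nlinarith
  obtain ⟨N, hN⟩ := eventually_atTop.1 hev
  exact ⟨N, fun u hu => hN u hu.le⟩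

theorem stmt_11 {S : Type} [Fintype S] [DecidableEq S] (hS : 2 ≤ Fintype.card S)
    {G : Type} [Group G] [Countable G]
    (q : S → S → ℝ)
    (hq_nonneg : ∀ i j : S, i ≠ j → 0 ≤ q i j)
    (hq_sym : ∀ i j : S, i ≠ j → (0 < q i j ↔ 0 < q j i))
    (hq_conn : ∀ i j : S, Relation.ReflTransGen (fun a b => a ≠ b ∧ 0 < q a b) i j)
    (πb : S → ℝ) (hπpos : ∀ i, 0 < πb i) (hπsum : ∑ i, πb i = 1)
    (hπstat : ∀ j : S,
      ∑ i ∈ Finset.univ.erase j, (πb i * q i j - πb j * q j i) = 0)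
    (σ : S → S → G) (hσ : ∀ i j, σ j i = (σ i j)⁻¹)
    (P : S × G → ℝ → S × G → ℝ) (hP : IsTransitionFamilyG q σ P)
    -- H_t^i < ∞ for all i and t ≥ 0:
    (hH : ∀ i : S, ∀ t : ℝ, 0 ≤ t →
      Summable (fun z => Real.negMulLog (P (i, (1 : G)) t z)))
    -- the folded distribution of p^{(i,e)}(t) converges to π̄ in total variation:
    (hTV : ∀ i : S,
      Tendsto (fun t : ℝ => ∑ j : S, |(∑' g : G, P (i, (1 : G)) t (j, g)) - πb j|)
        atTop (nhds 0))
    (C₁ : ℝ)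
    (hC₁ : Tendsto (fun t : ℝ => (∑ i : S, πb i * Hent (P (i, (1 : G)) t)) / t)
      atTop (nhds C₁)) :
    ∀ i : S, Tendsto (fun t : ℝ => Hent (P (i, (1 : G)) t) / t) atTop (nhds C₁) := by
  intro i
  refine tendsto_div_of_average_bounds hπpos (fun j t ht => ?_) (hTV i)
    (fun s t hs ht => (hP.entropy_add_bounds hH i hs ht).1)
    (fun s t hs ht => (hP.entropy_add_bounds hH i hs ht).2) hC₁
  exact tsum_nonneg fun z =>
    Real.negMulLog_nonneg (((hP.1 _).1 t ht).1 z) ((hP.1 _).le_one_s11 ht z)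

end
end
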